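/- arXiv:1802.03261 — 2 statements merged into one kernel-verified Lean document; each statement's English description precedes it below -/
import Mathlib

section
/- Let G : 𝒜 → ℬ be an exact functor between abelian categories, and let S be a collection of objects of 𝒜 such that: (1) every object of 𝒜 admits a finite filtration with graded pieces in S; (2) every object of ℬ admits a finite filtration with graded pieces in the image G(S); (3) for all X, Y ∈ S, the induced maps Ext^n_𝒜(X, Y) → Ext^n_ℬ(G(X), G(Y)) are bijective for all n ≥ 0. Then G is an equivalence of categories. -/
open CategoryTheory Category Limits

universe w₁ w₂ v₁ v₂ u₁ u₂ v u

/-- `Z` admits a finite filtration `0 = Z₀ ⊆ Z₁ ⊆ ⋯ ⊆ Zₙ = Z` (a chain of monomorphisms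
starting at a zero object and ending at `Z`) whose graded pieces `Z_{i+1}/Z_i` (the
cokernels) are isomorphic to objects in the collection `S`. -/
def HasFiltrationIn {C : Type u} [Category.{v} C] [Abelian C] (S : Set C) (Z : C) : Prop :=
  ∃ (n : ℕ) (F : Fin (n + 1) → C) (f : ∀ i : Fin n, F i.castSucc ⟶ F i.succ),
    (∀ i, Mono (f i)) ∧ IsZero (F 0) ∧ Nonempty (F (Fin.last n) ≅ Z) ∧
      ∀ i, ∃ s ∈ S, Nonempty (cokernel (f i) ≅ s)

theorem HasFiltrationIn.induct {C : Type u} [Category.{v} C] [Abelian C] (S : Set C)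
    (P : C → Prop) (hzero : ∀ X, IsZero X → P X) (hS : ∀ s ∈ S, P s)
    (hext : ∀ (T : ShortComplex C), T.ShortExact → P T.X₁ → P T.X₃ → P T.X₂)
    {Z : C} (hZ : HasFiltrationIn S Z) : P Z := by
  have hiso : ∀ {X Y : C}, (X ≅ Y) → P X → P Y := by
    intro X Y e hX
    refine hext (ShortComplex.mk e.hom (0 : Y ⟶ (HasZeroObject.zero' C).zero) (by simp)) ?_ hX
      (hzero _ (isZero_zero C))
    exact { exact := by
              rw [ShortComplex.exact_iff_epi _ rfl]
              dsimp; infer_instance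
            mono_f := by dsimp; infer_instance
            epi_g := by dsimp; exact (isZero_zero C).epi _ }
  obtain ⟨n, F, f, hf, h0, ⟨e⟩, hc⟩ := hZ
  refine hiso e ?_
  suffices h : ∀ i : Fin (n + 1), P (F i) from h _
  intro i
  induction i using Fin.induction with
  | zero => exact hzero _ h0
  | succ i hi =>
    have := hf i
    obtain ⟨s, hs, ⟨e'⟩⟩ := hc i
    refine hext (ShortComplex.mk (f i) (cokernel.π (f i)) (by simp)) ?_ hi
      (hiso e'.symm (hS s hs))
    exact { exact := ShortComplex.exact_cokernel _ }

section

open Abelian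

variable {C : Type u₁} [Category.{v₁} C] [Abelian C] [HasExt.{w₁} C]
  {D : Type u₂} [Category.{v₂} D] [Abelian D] [HasExt.{w₂} D]
  (F : C ⥤ D) [F.Additive] [PreservesFiniteLimits F] [PreservesFiniteColimits F]

theorem ext_subsingleton_of_isZero_src {X Y : C} (h : IsZero X) (n : ℕ) :
    Subsingleton (Ext.{w₁} X Y n) := by
  refine subsingleton_of_forall_eq 0 fun α => ?_
  rw [← Ext.mk₀_id_comp α, h.eq_of_src (𝟙 X) 0, Ext.mk₀_zero, Ext.zero_comp]

theorem ext_subsingleton_of_isZero_tgt {X Y : C} (h : IsZero Y) (n : ℕ) :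
    Subsingleton (Ext.{w₁} X Y n) := by
  refine subsingleton_of_forall_eq 0 fun α => ?_
  rw [← Ext.comp_mk₀_id α, h.eq_of_src (𝟙 Y) 0, Ext.mk₀_zero, Ext.comp_zero]

attribute [local simp] Ext.mapExactFunctor_comp Ext.mapExactFunctor_mk₀ Ext.mapExactFunctor_extClass

theorem mapExt_postcomp_square (X : C) {A B : C} (f : A ⟶ B) (n : ℕ) :
    ((Ext.mk₀ (F.map f)).postcomp (F.obj X) (add_zero n)).comp (F.mapExtAddHom X A n) =
      (F.mapExtAddHom X B n).comp ((Ext.mk₀ f).postcomp X (add_zero n)) := by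
  ext x
  exact ((Ext.mapExactFunctor_comp F x (Ext.mk₀ f) (add_zero n)).trans
    (by rw [Ext.mapExactFunctor_mk₀]; rfl)).symm

theorem mapExt_precomp_square (Y : C) {A B : C} (f : A ⟶ B) (n : ℕ) :
    ((Ext.mk₀ (F.map f)).precomp (F.obj Y) (zero_add n)).comp (F.mapExtAddHom B Y n) =
      (F.mapExtAddHom A Y n).comp ((Ext.mk₀ f).precomp Y (zero_add n)) := by
  ext x
  exact ((Ext.mapExactFunctor_comp F (Ext.mk₀ f) x (zero_add n)).trans
    (by rw [Ext.mapExactFunctor_mk₀]; rfl)).symm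

theorem mapExt_bij_covariant (X : C) (S : ShortComplex C) (hS : S.ShortExact)
    (h₁ : ∀ n, Function.Bijective (F.mapExtAddHom X S.X₁ n))
    (h₃ : ∀ n, Function.Bijective (F.mapExtAddHom X S.X₃ n)) (n : ℕ) :
    Function.Bijective (F.mapExtAddHom X S.X₂ n) := by
  have hS' := hS.map_of_exact F
  have e₂ := fun n => (ShortComplex.ab_exact_iff_function_exact _).1
    (Ext.covariant_sequence_exact₂' X hS n)
  have e₂' := fun n => (ShortComplex.ab_exact_iff_function_exact _).1
    (Ext.covariant_sequence_exact₂' (F.obj X) hS' n)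
  have e₃ := fun n => (ShortComplex.ab_exact_iff_function_exact _).1
    (Ext.covariant_sequence_exact₃' X hS n (n + 1) rfl)
  have e₃' := fun n => (ShortComplex.ab_exact_iff_function_exact _).1
    (Ext.covariant_sequence_exact₃' (F.obj X) hS' n (n + 1) rfl)
  have e₁ := fun n => (ShortComplex.ab_exact_iff_function_exact _).1
    (Ext.covariant_sequence_exact₁' X hS n (n + 1) rfl)
  have e₁' := fun n => (ShortComplex.ab_exact_iff_function_exact _).1
    (Ext.covariant_sequence_exact₁' (F.obj X) hS' n (n + 1) rfl)
  refine ⟨?_, AddMonoidHom.surjective_of_surjective_of_surjective_of_injective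
    ((Ext.mk₀ S.f).postcomp X (add_zero n)) _ _ _ _ _
    (F.mapExtAddHom X S.X₁ n) (F.mapExtAddHom X S.X₂ n) (F.mapExtAddHom X S.X₃ n)
    (F.mapExtAddHom X S.X₁ (n + 1)) (by cat_disch) (by cat_disch) (by cat_disch)
    (e₃ n) (e₂' n) (e₃' n) (h₁ n).2 (h₃ n).2 (h₁ (n + 1)).1⟩
  cases n with
  | zero =>
    have := hS'.mono_f
    exact AddMonoidHom.injective_of_surjective_of_injective_of_injective (0 : Unit →+ _) _ _
      (0 : Unit →+ _) _
      ((Ext.mk₀ (S.map F).g).postcomp (F.obj X) (add_zero _)) 0 (F.mapExtAddHom X S.X₁ 0) (F.mapExtAddHom X S.X₂ 0)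
      (F.mapExtAddHom X S.X₃ 0) (by simp) (mapExt_postcomp_square F X S.f _)
      (mapExt_postcomp_square F X S.g _)
      (fun y => by
        have := hS.mono_f
        have hi := Ext.postcomp_mk₀_injective_of_mono X S.f
        constructor
        · intro hy
          exact ⟨0, (hi (hy.trans (map_zero _).symm)).symm⟩
        · rintro ⟨_, rfl⟩
          exact map_zero _) (e₂ 0)
      (fun y => by
        have hi := Ext.postcomp_mk₀_injective_of_mono (F.obj X) (S.map F).f
        constructor
        · intro hy
          exact ⟨0, (hi (hy.trans (map_zero _).symm)).symm⟩
        · rintro ⟨_, rfl⟩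
          exact map_zero _) (fun x => ⟨x, rfl⟩) (h₁ 0).1 (h₃ 0).1
  | succ m =>
    exact AddMonoidHom.injective_of_surjective_of_injective_of_injective _ _ _ _ _
      ((Ext.mk₀ (S.map F).g).postcomp (F.obj X) (add_zero _))
      (F.mapExtAddHom X S.X₃ m) (F.mapExtAddHom X S.X₁ (m + 1)) (F.mapExtAddHom X S.X₂ (m + 1))
      (F.mapExtAddHom X S.X₃ (m + 1)) (by cat_disch) (mapExt_postcomp_square F X S.f _)
      (mapExt_postcomp_square F X S.g _)
      (e₁ m) (e₂ (m + 1)) (e₁' m) (h₃ m).2 (h₁ (m + 1)).1 (h₃ (m + 1)).1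

theorem mapExt_bij_contravariant (Y : C) (S : ShortComplex C) (hS : S.ShortExact)
    (h₁ : ∀ n, Function.Bijective (F.mapExtAddHom S.X₁ Y n))
    (h₃ : ∀ n, Function.Bijective (F.mapExtAddHom S.X₃ Y n)) (n : ℕ) :
    Function.Bijective (F.mapExtAddHom S.X₂ Y n) := by
  have hS' := hS.map_of_exact F
  have e₂ := fun n => (ShortComplex.ab_exact_iff_function_exact _).1
    (Ext.contravariant_sequence_exact₂' hS Y n)
  have e₂' := fun n => (ShortComplex.ab_exact_iff_function_exact _).1
    (Ext.contravariant_sequence_exact₂' hS' (F.obj Y) n)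
  have e₁ := fun n => (ShortComplex.ab_exact_iff_function_exact _).1
    (Ext.contravariant_sequence_exact₁' hS Y n (n + 1) (add_comm 1 n))
  have e₁' := fun n => (ShortComplex.ab_exact_iff_function_exact _).1
    (Ext.contravariant_sequence_exact₁' hS' (F.obj Y) n (n + 1) (add_comm 1 n))
  have e₃ := fun n => (ShortComplex.ab_exact_iff_function_exact _).1
    (Ext.contravariant_sequence_exact₃' hS Y n (n + 1) (add_comm 1 n))
  have e₃' := fun n => (ShortComplex.ab_exact_iff_function_exact _).1
    (Ext.contravariant_sequence_exact₃' hS' (F.obj Y) n (n + 1) (add_comm 1 n))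
  refine ⟨?_, AddMonoidHom.surjective_of_surjective_of_surjective_of_injective
    ((Ext.mk₀ S.g).precomp Y (zero_add n)) _ _ _ _ _
    (F.mapExtAddHom S.X₃ Y n) (F.mapExtAddHom S.X₂ Y n) (F.mapExtAddHom S.X₁ Y n)
    (F.mapExtAddHom S.X₃ Y (n + 1)) (by cat_disch) (by cat_disch) (by cat_disch)
    (e₁ n) (e₂' n) (e₁' n) (h₃ n).2 (h₁ n).2 (h₃ (n + 1)).1⟩
  cases n with
  | zero =>
    have := hS'.epi_g
    exact AddMonoidHom.injective_of_surjective_of_injective_of_injective (0 : Unit →+ _) _ _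
      (0 : Unit →+ _) _
      ((Ext.mk₀ (S.map F).f).precomp (F.obj Y) (zero_add _)) 0 (F.mapExtAddHom S.X₃ Y 0) (F.mapExtAddHom S.X₂ Y 0)
      (F.mapExtAddHom S.X₁ Y 0) (by simp) (mapExt_precomp_square F Y S.g _)
      (mapExt_precomp_square F Y S.f _)
      (fun y => by
        have := hS.epi_g
        have hi := Ext.precomp_mk₀_injective_of_epi Y S.g
        constructor
        · intro hy
          exact ⟨0, (hi (hy.trans (map_zero _).symm)).symm⟩
        · rintro ⟨_, rfl⟩
          exact map_zero _) (e₂ 0)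
      (fun y => by
        have hi := Ext.precomp_mk₀_injective_of_epi (F.obj Y) (S.map F).g
        constructor
        · intro hy
          exact ⟨0, (hi (hy.trans (map_zero _).symm)).symm⟩
        · rintro ⟨_, rfl⟩
          exact map_zero _) (fun x => ⟨x, rfl⟩) (h₃ 0).1 (h₁ 0).1
  | succ m =>
    exact AddMonoidHom.injective_of_surjective_of_injective_of_injective _ _ _ _ _
      ((Ext.mk₀ (S.map F).f).precomp (F.obj Y) (zero_add _))
      (F.mapExtAddHom S.X₁ Y m) (F.mapExtAddHom S.X₃ Y (m + 1)) (F.mapExtAddHom S.X₂ Y (m + 1))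
      (F.mapExtAddHom S.X₁ Y (m + 1)) (by cat_disch) (mapExt_precomp_square F Y S.g _)
      (mapExt_precomp_square F Y S.f _)
      (e₃ m) (e₂ (m + 1)) (e₃' m) (h₁ m).2 (h₃ (m + 1)).1 (h₁ (m + 1)).1

theorem bijective_mapExt_of_isZero {X Y : C} (h : IsZero X ∨ IsZero Y) (n : ℕ) :
    Function.Bijective (F.mapExtAddHom X Y n) := by
  have h1 : Subsingleton (Ext.{w₁} X Y n) :=
    h.elim (fun h => ext_subsingleton_of_isZero_src h n)
      (fun h => ext_subsingleton_of_isZero_tgt h n)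
  have h2 : Subsingleton (Ext.{w₂} (F.obj X) (F.obj Y) n) :=
    h.elim (fun h => ext_subsingleton_of_isZero_src (F.map_isZero h) n)
      (fun h => ext_subsingleton_of_isZero_tgt (F.map_isZero h) n)
  exact ⟨fun _ _ _ => Subsingleton.elim _ _, fun y => ⟨0, Subsingleton.elim _ _⟩⟩

theorem bijective_mapExt_of_filtration (S : Set C) (h1 : ∀ Z : C, HasFiltrationIn S Z)
    (h3 : ∀ X ∈ S, ∀ Y ∈ S, ∀ n : ℕ, Function.Bijective (F.mapExtAddHom X Y n))
    (X Y : C) : ∀ n : ℕ, Function.Bijective (F.mapExtAddHom X Y n) := by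
  refine (h1 X).induct S (fun X => ∀ n, Function.Bijective (F.mapExtAddHom X Y n))
    (fun X hX => bijective_mapExt_of_isZero F (.inl hX)) (fun X hX => ?_)
    (fun T hT a b => mapExt_bij_contravariant F Y T hT a b)
  exact (h1 Y).induct S (fun Y => ∀ n, Function.Bijective (F.mapExtAddHom X Y n))
    (fun Y hY => bijective_mapExt_of_isZero F (.inr hY)) (h3 X hX)
    (fun T hT a b => mapExt_bij_covariant F X T hT a b)

end

section

variable {C₁ : Type u₁} [Category.{v₁} C₁] [Abelian C₁] [HasDerivedCategory.{w₁} C₁]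
  {C₂ : Type u₂} [Category.{v₂} C₂] [Abelian C₂] [HasDerivedCategory.{w₂} C₂]
  (G : C₁ ⥤ C₂) [G.Additive] [PreservesFiniteLimits G] [PreservesFiniteColimits G]

/-- The canonical identification of the image, under the derived functor of an exact
functor `G`, of the complex consisting of `X` placed in degree `0`, with the complex
consisting of `G.obj X` placed in degree `0`. -/
noncomputable def mapDerivedCategorySingleObjIso (X : C₁) :
    G.mapDerivedCategory.obj ((DerivedCategory.singleFunctor C₁ 0).obj X) ≅
      (DerivedCategory.singleFunctor C₂ 0).obj (G.obj X) :=
  G.mapDerivedCategory.mapIso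
      (((SingleFunctors.evaluation _ _ 0).mapIso
        (DerivedCategory.singleFunctorsPostcompQIso C₁)).app X) ≪≫
    G.mapDerivedCategoryFactors.app ((CochainComplex.singleFunctor C₁ 0).obj X) ≪≫
    DerivedCategory.Q.mapIso
      ((HomologicalComplex.singleMapHomologicalComplex G (ComplexShape.up ℤ) 0).app X) ≪≫
    (((SingleFunctors.evaluation _ _ 0).mapIso
      (DerivedCategory.singleFunctorsPostcompQIso C₂)).app (G.obj X)).symm

/-- The map `Ext^n_{C₁}(X, Y) → Ext^n_{C₂}(G X, G Y)` induced by an exact functor `G`,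
where `Ext^n(X, Y)` is realized as `Hom((X)[0], (Y)[0]⟦n⟧)` in the derived category. -/
noncomputable def inducedExtMap (X Y : C₁) (n : ℤ) :
    ((DerivedCategory.singleFunctor C₁ 0).obj X ⟶
      ((DerivedCategory.singleFunctor C₁ 0).obj Y)⟦n⟧) →
    ((DerivedCategory.singleFunctor C₂ 0).obj (G.obj X) ⟶
      ((DerivedCategory.singleFunctor C₂ 0).obj (G.obj Y))⟦n⟧) :=
  fun φ => (mapDerivedCategorySingleObjIso G X).inv ≫ G.mapDerivedCategory.map φ ≫
    (G.mapDerivedCategory.commShiftIso n).hom.app ((DerivedCategory.singleFunctor C₁ 0).obj Y) ≫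
    (shiftFunctor (DerivedCategory C₂) n).map (mapDerivedCategorySingleObjIso G Y).hom

section

open Abelian DerivedCategory Pretriangulated


theorem mapDerivedCategorySingleObjIso_eq (X : C₁) :
    mapDerivedCategorySingleObjIso G X = (G.mapDerivedCategorySingleFunctor 0).app X := by
  ext
  have h₁ : ((singleFunctorsPostcompQIso C₁).hom.hom 0).app X = 𝟙 _ := by
    rw [singleFunctorsPostcompQIso_hom_hom]; rfl
  have h₂ : ((singleFunctorsPostcompQIso C₂).inv.hom 0).app (G.obj X) = 𝟙 _ := by
    rw [singleFunctorsPostcompQIso_inv_hom]; rfl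
  change G.mapDerivedCategory.map (((singleFunctorsPostcompQIso C₁).hom.hom 0).app X) ≫
    G.mapDerivedCategoryFactors.hom.app _ ≫
    DerivedCategory.Q.map _ ≫ ((singleFunctorsPostcompQIso C₂).inv.hom 0).app (G.obj X) =
    G.mapDerivedCategory.map (𝟙 _) ≫ 𝟙 _ ≫ G.mapDerivedCategoryFactors.hom.app _ ≫
    𝟙 _ ≫ DerivedCategory.Q.map _ ≫ 𝟙 _ ≫ 𝟙 _
  rw [h₁, h₂, Category.id_comp, Category.id_comp, Category.id_comp]
  rfl

theorem inducedExtMap_hom [HasExt.{w₁} C₁] [HasExt.{w₂} C₂] {X Y : C₁} {n : ℕ}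
    (e : Ext.{w₁} X Y n) :
    inducedExtMap G X Y n e.hom = (e.mapExactFunctor G).hom := by
  rw [Ext.mapExactFunctor_hom]
  simp [inducedExtMap, mapDerivedCategorySingleObjIso_eq, ShiftedHom.map]

theorem inducedExtMap_bijective_iff [HasExt.{w₁} C₁] [HasExt.{w₂} C₂] (X Y : C₁) (n : ℕ) :
    Function.Bijective (inducedExtMap G X Y n) ↔
      Function.Bijective (G.mapExtAddHom X Y n) := by
  have : inducedExtMap G X Y n ∘ (Ext.homEquiv (X := X) (Y := Y) (n := n)) =
      (Ext.homEquiv (X := G.obj X) (Y := G.obj Y) (n := n)) ∘ (G.mapExtAddHom X Y n) := by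
    ext e
    exact inducedExtMap_hom G e
  rw [← Function.Bijective.of_comp_iff _ (Ext.homEquiv (X := X) (Y := Y) (n := n)).bijective,
    this, Function.Bijective.of_comp_iff' (Equiv.bijective _)]

theorem essImage_ext
    (h : ∀ X Y : C₁, Function.Surjective (inducedExtMap G X Y (1 : ℤ)))
    (T : ShortComplex C₂) (hT : T.ShortExact) (hA : G.essImage T.X₁) (hB : G.essImage T.X₃) :
    G.essImage T.X₂ := by
  obtain ⟨A, ⟨a⟩⟩ := hA
  obtain ⟨B, ⟨b⟩⟩ := hB
  obtain ⟨φ, hφ⟩ := h B A ((singleFunctor C₂ 0).map b.hom ≫ hT.singleδ ≫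
    ((singleFunctor C₂ 0).map a.inv)⟦(1 : ℤ)⟧')
  obtain ⟨E, f, g, hE⟩ := distinguished_cocone_triangle₂ φ
  have hLE : E.IsLE 0 := TStructure.t.isLE₂ _ hE 0
    (inferInstanceAs (((singleFunctor C₁ 0).obj A).IsLE 0))
    (inferInstanceAs (((singleFunctor C₁ 0).obj B).IsLE 0))
  have hGE : E.IsGE 0 := TStructure.t.isGE₂ _ hE 0
    (inferInstanceAs (((singleFunctor C₁ 0).obj A).IsGE 0))
    (inferInstanceAs (((singleFunctor C₁ 0).obj B).IsGE 0))
  obtain ⟨M, ⟨m⟩⟩ := exists_iso_singleFunctor_obj_of_isGE_of_isLE E 0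
  have hE' := G.mapDerivedCategory.map_distinguished _ hE
  have hT' := hT.singleTriangle_distinguished
  let ea := mapDerivedCategorySingleObjIso G A ≪≫ (singleFunctor C₂ 0).mapIso a
  let eb := mapDerivedCategorySingleObjIso G B ≪≫ (singleFunctor C₂ 0).mapIso b
  have comm : (G.mapDerivedCategory.map φ ≫ (G.mapDerivedCategory.commShiftIso (1 : ℤ)).hom.app
      ((singleFunctor C₁ 0).obj A)) ≫ ea.hom⟦(1 : ℤ)⟧' = eb.hom ≫ hT.singleδ := by
    have := congr((mapDerivedCategorySingleObjIso G B).hom ≫ $hφ ≫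
      ((singleFunctor C₂ 0).map a.hom)⟦(1 : ℤ)⟧')
    simp only [inducedExtMap, Category.assoc, Iso.hom_inv_id_assoc, ← Functor.map_comp,
      Iso.inv_hom_id] at this
    simpa [ea, eb] using this
  obtain ⟨c, hc₁, hc₂⟩ := complete_distinguished_triangle_morphism₂ _ _ hE' hT' ea.hom eb.hom comm
  have hc : IsIso c := isIso₂_of_isIso₁₃ (Triangle.homMk (G.mapDerivedCategory.mapTriangle.obj (Triangle.mk f g φ))
      hT.singleTriangle ea.hom c eb.hom hc₁ hc₂ comm) hE' hT'
    (inferInstanceAs (IsIso ea.hom)) (inferInstanceAs (IsIso eb.hom))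
  exact ⟨M, ⟨(singleFunctor C₂ 0).preimageIso ((mapDerivedCategorySingleObjIso G M).symm ≪≫
    G.mapDerivedCategory.mapIso m.symm ≪≫ @asIso _ _ _ _ c hc)⟩⟩

end

/-- Let `G : C₁ ⥤ C₂` be an exact functor between abelian categories and `S` a collection
of objects of `C₁` such that: (1) every object of `C₁` admits a finite filtration with
graded pieces in `S`; (2) every object of `C₂` admits a finite filtration with graded
pieces in `G(S)`; (3) for all `X, Y ∈ S` and `n ≥ 0` the induced maps
`Ext^n_{C₁}(X, Y) → Ext^n_{C₂}(G X, G Y)` are bijective. Then `G` is an equivalence of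
categories. -/
theorem stmt_3 (S : Set C₁)
    (h1 : ∀ Z : C₁, HasFiltrationIn S Z)
    (h2 : ∀ Z : C₂, HasFiltrationIn (G.obj '' S) Z)
    (h3 : ∀ X ∈ S, ∀ Y ∈ S, ∀ n : ℕ,
      Function.Bijective (inducedExtMap G X Y (n : ℤ))) :
    G.IsEquivalence := by
  have : HasExt.{w₁} C₁ := hasExt_of_hasDerivedCategory C₁
  have : HasExt.{w₂} C₂ := hasExt_of_hasDerivedCategory C₂
  have key := bijective_mapExt_of_filtration G S h1
    (fun X hX Y hY n => (inducedExtMap_bijective_iff G X Y n).1 (h3 X hX Y hY n))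
  have hff : ∀ X Y : C₁, Function.Bijective (G.map : (X ⟶ Y) → _) := fun X Y => by
    have := key X Y 0
    rw [Functor.mapExtAddHom_coe, Abelian.Ext.mapExactFunctor₀] at this
    simpa using this
  have : G.Faithful := ⟨fun {X Y} => (hff X Y).1⟩
  have : G.Full := ⟨fun {X Y} => (hff X Y).2⟩
  have : G.EssSurj := ⟨fun Z => (h2 Z).induct (G.obj '' S) G.essImage
    (fun X hX => ⟨(HasZeroObject.zero' C₁).zero,
      ⟨(G.map_isZero (isZero_zero C₁)).iso hX⟩⟩)
    (by rintro _ ⟨s, -, rfl⟩; exact G.obj_mem_essImage s)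
    (essImage_ext G (fun X Y => ((inducedExtMap_bijective_iff G X Y 1).2 (key X Y 1)).2))⟩
  exact { }

end
end

section
/- Let p be a prime and A a commutative ring such that A[p^∞] = A[p^c] for some c (bounded p-power torsion). Let M be an A-module which is p-adically complete and separated (M ≅ lim_n M/p^nM), such that M/pM is a flat A/pA-module and Tor_1^A(M, A/pA) = 0. Then for every n ≥ 1, the natural map M ⊗_A A[p^n] → M[p^n] is an isomorphism; in particular M[p^∞] = M[p^c]. -/
open TensorProduct Pointwise

universe u

open CategoryTheory in
lemma tor_data {A : Type u} [CommRing A] (M N : Type u) [AddCommGroup M] [Module A M]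
    [AddCommGroup N] [Module A N]
    (htor : CategoryTheory.Limits.IsZero (((CategoryTheory.Tor (ModuleCat.{u} A) 1).obj
      (ModuleCat.of A M)).obj (ModuleCat.of A N))) :
    ∃ (P2 P1 P0 : ModuleCat.{u} A) (d2 : P2 →ₗ[A] P1) (d1 : P1 →ₗ[A] P0) (e : P0 →ₗ[A] N),
      Module.Projective A P0 ∧ Function.Exact d2 d1 ∧ Function.Exact d1 e ∧
      Function.Surjective e ∧ Function.Exact (d2.lTensor M) (d1.lTensor M) := by
  let P : ProjectiveResolution (ModuleCat.of A N) := projectiveResolution _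
  have h1 := htor.of_iso (P.isoLeftDerivedObj ((MonoidalCategory.tensoringLeft (ModuleCat.{u} A)).obj (ModuleCat.of A M)) 1).symm
  refine ⟨P.complex.X 2, P.complex.X 1, P.complex.X 0, (P.complex.d 2 1).hom, (P.complex.d 1 0).hom, (P.π.f 0).hom, ?_, ?_, ?_, ?_, ?_⟩
  · rw [IsProjective.iff_projective]
    exact P.projective 0
  · exact (ShortComplex.ShortExact.moduleCat_exact_iff_function_exact _).1 (P.exact_succ 0)
  · exact (ShortComplex.ShortExact.moduleCat_exact_iff_function_exact _).1 P.exact₀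
  · exact (ModuleCat.epi_iff_surjective _).1 (inferInstanceAs (Epi (P.π.f 0)))
  · have h2 := (HomologicalComplex.exactAt_iff_isZero_homology _ _).2 h1
    rw [HomologicalComplex.exactAt_iff' _ 2 1 0 (by simp) (by simp)] at h2
    exact (ShortComplex.ShortExact.moduleCat_exact_iff_function_exact _).1 h2

lemma tor_inj {A : Type u} [CommRing A] (M N : Type u) [AddCommGroup M] [Module A M]
    [AddCommGroup N] [Module A N]
    (htor : CategoryTheory.Limits.IsZero (((CategoryTheory.Tor (ModuleCat.{u} A) 1).obj
      (ModuleCat.of A M)).obj (ModuleCat.of A N)))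
    {X Y : Type u} [AddCommGroup X] [Module A X] [AddCommGroup Y] [Module A Y]
    (i : X →ₗ[A] Y) (f : Y →ₗ[A] N) (hi : Function.Injective i) (hif : Function.Exact i f)
    (hf : Function.Surjective f) : Function.Injective (i.lTensor M) := by
  obtain ⟨P2, P1, P0, d2, d1, e, hP, h21, h10, he, hM⟩ := tor_data M N htor
  obtain ⟨g, hg⟩ := Module.projective_lifting_property f e hf
  have hg' : ∀ x, f (g x) = e x := fun x => LinearMap.congr_fun hg x
  have hψ : ∀ q, ∃ x, i x = g (d1 q) := fun q => (hif _).1 (by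
    rw [hg']; exact h10.apply_apply_eq_zero q)
  choose ψ0 hψ0 using hψ
  let ψ : P1 →ₗ[A] X :=
    { toFun := ψ0
      map_add' := fun a b => hi (by simp [hψ0])
      map_smul' := fun a b => hi (by simp [hψ0]) }
  have hψ : ∀ q, i (ψ q) = g (d1 q) := hψ0
  have hex : Function.Exact (d1.prod (-ψ)) (g.coprod i) := by
    rintro ⟨a, x⟩
    constructor
    · intro h
      simp only [LinearMap.coprod_apply] at h
      have : e a = 0 := by
        have h' := congrArg f h
        rwa [map_add, hif.apply_apply_eq_zero, add_zero, map_zero, hg'] at h'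
      obtain ⟨q, rfl⟩ := (h10 _).1 this
      refine ⟨q, ?_⟩
      ext
      · rfl
      · apply hi
        change i (-(ψ q)) = i x
        rw [map_neg, hψ]
        exact (eq_neg_iff_add_eq_zero.2 (by rwa [add_comm] at h)).symm
    · rintro ⟨q, hq⟩
      rw [← hq]
      simp [hψ]
  have hs : Function.Surjective (g.coprod i) := by
    intro y
    obtain ⟨a, ha⟩ := he (f y)
    obtain ⟨x, hx⟩ := (hif (y - g a)).1 (by rw [map_sub, hg', ha, sub_self])
    exact ⟨(a, x), by simp [hx]⟩
  have hex' := lTensor_exact M hex hs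
  rw [injective_iff_map_eq_zero]
  intro ξ hξ
  obtain ⟨κ, hκ⟩ := (hex' ((LinearMap.inr A P0 X).lTensor M ξ)).1 (by
    rw [← LinearMap.lTensor_comp_apply, LinearMap.coprod_inr, hξ])
  have h1 := congrArg ((LinearMap.fst A P0 X).lTensor M) hκ
  have h2 := congrArg ((LinearMap.snd A P0 X).lTensor M) hκ
  simp only [← LinearMap.lTensor_comp_apply, LinearMap.fst_prod, LinearMap.snd_prod,
    LinearMap.fst_comp_inr, LinearMap.snd_comp_inr, LinearMap.lTensor_zero, LinearMap.lTensor_id,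
    LinearMap.zero_apply, LinearMap.id_apply] at h1 h2
  obtain ⟨l, rfl⟩ := (hM κ).1 h1
  rw [← h2, ← LinearMap.lTensor_comp_apply]
  have : (-ψ) ∘ₗ d2 = 0 := by
    ext z
    apply hi
    simp [hψ, h21.apply_apply_eq_zero]
  rw [this]; simp

/-- ideal step -/
lemma ideal_step {A : Type u} [CommRing A] (M : Type u) [AddCommGroup M] [Module A M] (p : A)
    (I I' J : Ideal A) (hJ : J = I ⊔ Ideal.span {p}) (hI' : ∀ a, a ∈ I' ↔ p * a ∈ I)
    (h1 : Function.Injective (LinearMap.lTensor M I'.subtype))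
    (h2 : Function.Injective (LinearMap.lTensor M J.subtype)) :
    Function.Injective (LinearMap.lTensor M I.subtype) := by
  have hIJ : I ≤ J := by rw [hJ]; exact le_sup_left
  have hpJ : p ∈ J := by rw [hJ]; exact Ideal.mem_sup_right (Ideal.mem_span_singleton_self p)
  let i : I →ₗ[A] J := Submodule.inclusion hIJ
  let g : A →ₗ[A] J := LinearMap.toSpanSingleton A J ⟨p, hpJ⟩
  let ψ : I' →ₗ[A] I := ((LinearMap.mulLeft A p) ∘ₗ I'.subtype).codRestrict I
    (fun x => (hI' _).1 x.2)
  have hex : Function.Exact (I'.subtype.prod (-ψ)) (g.coprod i) := by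
    rintro ⟨a, x⟩
    have hh : (g.coprod i) (a, x) = 0 ↔ a * p + x = 0 := by
      rw [← Subtype.coe_inj]; rfl
    rw [hh]
    constructor
    · intro h
      have hx : (x : A) = - (p * a) := by linear_combination h
      refine ⟨⟨a, (hI' a).2 ?_⟩, ?_⟩
      · have := I.neg_mem x.2
        rwa [hx, neg_neg] at this
      · ext
        · rfl
        · exact hx.symm
    · rintro ⟨q, hq⟩
      have e1 : (q : A) = a := congrArg Prod.fst hq
      have e2 : -(p * (q : A)) = x := congrArg (fun t => (t.2 : A)) hq
      rw [← e2, ← e1]; ring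
  have hs : Function.Surjective (g.coprod i) := by
    rintro ⟨y, hy⟩
    have hy' := hy
    rw [hJ, Submodule.mem_sup] at hy'
    obtain ⟨x, hx, z, hz, rfl⟩ := hy'
    obtain ⟨a, rfl⟩ := Ideal.mem_span_singleton'.1 hz
    refine ⟨(a, ⟨x, hx⟩), Subtype.ext ?_⟩
    change a * p + x = _
    ring
  have hex' := lTensor_exact M hex hs
  rw [injective_iff_map_eq_zero]
  intro ξ hξ
  have hξ' : i.lTensor M ξ = 0 := by
    apply h2
    rw [← LinearMap.lTensor_comp_apply, map_zero]
    exact hξ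
  obtain ⟨κ, hκ⟩ := (hex' ((LinearMap.inr A A I).lTensor M ξ)).1 (by
    rw [← LinearMap.lTensor_comp_apply, LinearMap.coprod_inr, hξ'])
  have e1 := congrArg ((LinearMap.fst A A I).lTensor M) hκ
  have e2 := congrArg ((LinearMap.snd A A I).lTensor M) hκ
  simp only [← LinearMap.lTensor_comp_apply, LinearMap.fst_prod, LinearMap.snd_prod,
    LinearMap.fst_comp_inr, LinearMap.snd_comp_inr, LinearMap.lTensor_zero, LinearMap.lTensor_id,
    LinearMap.zero_apply, LinearMap.id_apply] at e1 e2
  have : κ = 0 := h1 (by rw [e1, map_zero])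
  rw [← e2, this, map_zero]

lemma flat_inj {A : Type u} [CommRing A] (M : Type u) [AddCommGroup M] [Module A M] (p : A)
    (hflat : Module.Flat (A ⧸ Ideal.span {p}) (M ⧸ (p • (⊤ : Submodule A M))))
    {X Y : Type u} [AddCommGroup X] [Module A X] [AddCommGroup Y] [Module A Y]
    [Module (A ⧸ Ideal.span {p}) X] [Module (A ⧸ Ideal.span {p}) Y]
    [IsScalarTower A (A ⧸ Ideal.span {p}) X] [IsScalarTower A (A ⧸ Ideal.span {p}) Y]
    (f : X →ₗ[A ⧸ Ideal.span {p}] Y) (hf : Function.Injective f) :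
    Function.Injective ((f.restrictScalars A).lTensor M) := by
  let B := A ⧸ Ideal.span {p}
  have hsub : Ideal.span {p} • (⊤ : Submodule A M) = p • (⊤ : Submodule A M) := by
    rw [Submodule.ideal_span_singleton_smul]
  let e0 : (B ⊗[A] M) ≃ₗ[A] (M ⧸ (p • (⊤ : Submodule A M))) :=
    (TensorProduct.quotTensorEquivQuotSMul M (Ideal.span {p})).trans
      (Submodule.quotEquivOfEq _ _ hsub)
  have hsurj : Function.Surjective (algebraMap A B) := Ideal.Quotient.mk_surjective
  let e : (B ⊗[A] M) ≃ₗ[B] (M ⧸ (p • (⊤ : Submodule A M))) :=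
    e0.extendScalarsOfSurjective hsurj
  have : Module.Flat B (B ⊗[A] M) := Module.Flat.of_linearEquiv e
  have h1 : Function.Injective (f.rTensor (B ⊗[A] M)) :=
    Module.Flat.rTensor_preserves_injective_linearMap f hf
  have h2 : Function.Injective ((f.restrictScalars A).rTensor M) := by
    have hc : ∀ z, (f.restrictScalars A).rTensor M (AlgebraTensorModule.cancelBaseChange A B B X M z) = AlgebraTensorModule.cancelBaseChange A B B Y M (f.rTensor (B ⊗[A] M) z) := by
      intro z
      induction z with
      | zero => simp
      | add a b ha hb => simp [ha, hb]
      | tmul x w =>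
        induction w with
        | zero => simp
        | add a b ha hb => simp only [tmul_add, map_add, ha, hb]
        | tmul b m =>
          have e2 : f.rTensor (B ⊗[A] M) (x ⊗ₜ[B] (b ⊗ₜ[A] m)) = f x ⊗ₜ[B] (b ⊗ₜ[A] m) := rfl
          have e3 : f (b • x) = b • f x := f.map_smul b x
          refine Eq.trans ?_ (congrArg (AlgebraTensorModule.cancelBaseChange A B B Y M) e2).symm
          rw [AlgebraTensorModule.cancelBaseChange_tmul, AlgebraTensorModule.cancelBaseChange_tmul,
            LinearMap.rTensor_tmul, LinearMap.restrictScalars_apply, e3]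
    intro x y hxy
    obtain ⟨x, rfl⟩ := (AlgebraTensorModule.cancelBaseChange A B B X M).surjective x
    obtain ⟨y, rfl⟩ := (AlgebraTensorModule.cancelBaseChange A B B X M).surjective y
    rw [hc, hc] at hxy
    rw [h1 ((AlgebraTensorModule.cancelBaseChange A B B Y M).injective hxy)]
  rw [← LinearMap.lTensor_inj_iff_rTensor_inj] at h2
  exact h2

lemma ideal_base {A : Type u} [CommRing A] (M : Type u) [AddCommGroup M] [Module A M] (p : A)
    (hflat : Module.Flat (A ⧸ Ideal.span {p}) (M ⧸ (p • (⊤ : Submodule A M))))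
    (h1 : Function.Injective (LinearMap.lTensor M (Ideal.span {p}).subtype))
    (J : Ideal A) (hp : p ∈ J) :
    Function.Injective (LinearMap.lTensor M J.subtype) := by
  have hle : Ideal.span {p} ≤ J := by rwa [Ideal.span_singleton_le_iff_mem]
  let Jb : Ideal (A ⧸ Ideal.span {p}) := J.map (Ideal.Quotient.mk _)
  let q : J →ₗ[A] Jb :=
    { toFun := fun x => ⟨Ideal.Quotient.mk _ x.1, Ideal.mem_map_of_mem _ x.2⟩
      map_add' := fun _ _ => rfl
      map_smul' := fun _ _ => rfl }
  have hq : Function.Surjective q := by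
    rintro ⟨y, hy⟩
    obtain ⟨x, hx, rfl⟩ := (Ideal.mem_map_iff_of_surjective _ Ideal.Quotient.mk_surjective).1 hy
    exact ⟨⟨x, hx⟩, rfl⟩
  have hex : Function.Exact (Submodule.inclusion hle) q := by
    rintro ⟨x, hx⟩
    have : q ⟨x, hx⟩ = 0 ↔ x ∈ Ideal.span {p} := by
      rw [← Ideal.Quotient.eq_zero_iff_mem, ← Subtype.coe_inj]; rfl
    rw [this]
    constructor
    · intro h; exact ⟨⟨x, h⟩, rfl⟩
    · rintro ⟨⟨y, hy⟩, h⟩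
      have : y = x := congrArg Subtype.val h
      rwa [← this]
  have hex' := lTensor_exact M hex hq
  have hJ := flat_inj M p hflat Jb.subtype Jb.injective_subtype
  rw [injective_iff_map_eq_zero]
  intro ξ hξ
  have h3 : q.lTensor M ξ = 0 := by
    apply hJ
    rw [← LinearMap.lTensor_comp_apply, map_zero]
    have : (Jb.subtype.restrictScalars A) ∘ₗ q = (Submodule.mkQ (Ideal.span {p})) ∘ₗ J.subtype := rfl
    rw [this, LinearMap.lTensor_comp_apply, hξ, map_zero]
  obtain ⟨κ, rfl⟩ := (hex' ξ).1 h3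
  rw [← LinearMap.lTensor_comp_apply] at hξ
  have : κ = 0 := h1 (by rw [map_zero]; exact hξ)
  rw [this, map_zero]

lemma ideal_all {A : Type u} [CommRing A] (M : Type u) [AddCommGroup M] [Module A M] (p : A)
    (hflat : Module.Flat (A ⧸ Ideal.span {p}) (M ⧸ (p • (⊤ : Submodule A M))))
    (h1 : Function.Injective (LinearMap.lTensor M (Ideal.span {p}).subtype))
    (k : ℕ) : ∀ I : Ideal A, p ^ k ∈ I → Function.Injective (LinearMap.lTensor M I.subtype) := by
  induction k with
  | zero =>
    intro I hI
    refine ideal_base M p hflat h1 I ?_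
    rw [pow_zero] at hI
    rw [(Ideal.eq_top_iff_one I).2 hI]; trivial
  | succ k ih =>
    intro I hI
    let I' : Ideal A := Submodule.comap (LinearMap.mulLeft A p) I
    have hI' : ∀ a, a ∈ I' ↔ p * a ∈ I := fun a => Iff.rfl
    refine ideal_step M p I I' _ rfl hI' (ih I' ?_) (ideal_base M p hflat h1 _ ?_)
    · rw [hI', ← pow_succ']; exact hI
    · exact Ideal.mem_sup_right (Ideal.mem_span_singleton_self p)

theorem stmt_19 (p : ℕ) (hp : p.Prime) {A : Type u} [CommRing A] (c : ℕ)
    (hc : ∀ (n : ℕ) (a : A), (p : A) ^ n * a = 0 → (p : A) ^ c * a = 0)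
    (M : Type u) [AddCommGroup M] [Module A M]
    (hsep : ∀ x : M, (∀ n : ℕ, ∃ y : M, x = (p : A) ^ n • y) → x = 0)
    (hcompl : ∀ a : ℕ → M, (∀ n, ∃ b : M, a (n + 1) - a n = (p : A) ^ n • b) →
      ∃ m : M, ∀ n, ∃ b : M, m - a n = (p : A) ^ n • b)
    (hflat : Module.Flat (A ⧸ Ideal.span {(p : A)})
      (M ⧸ ((p : A) • (⊤ : Submodule A M))))
    (htor : CategoryTheory.Limits.IsZero (((CategoryTheory.Tor (ModuleCat.{u} A) 1).obj (ModuleCat.of A M)).obj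
      (ModuleCat.of A (A ⧸ Ideal.span {(p : A)})))) :
    (∀ n : ℕ, 1 ≤ n →
      Function.Injective
        ((TensorProduct.rid A M).toLinearMap ∘ₗ
          LinearMap.lTensor M (Submodule.torsionBy A A ((p : A) ^ n)).subtype) ∧
      LinearMap.range
        ((TensorProduct.rid A M).toLinearMap ∘ₗ
          LinearMap.lTensor M (Submodule.torsionBy A A ((p : A) ^ n)).subtype) =
        Submodule.torsionBy A M ((p : A) ^ n)) ∧
    (∀ x : M, (∃ n : ℕ, (p : A) ^ n • x = 0) → (p : A) ^ c • x = 0) := by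
  have hbase : Function.Injective (LinearMap.lTensor M (Ideal.span {(p : A)}).subtype) := by
    refine tor_inj M _ htor _ (Submodule.mkQ (Ideal.span {(p : A)}))
      (Submodule.injective_subtype _) ?_ (Submodule.mkQ_surjective _)
    exact LinearMap.exact_subtype_mkQ _
  have hall := fun k I hI => ideal_all M (p : A) hflat hbase k I hI
  -- any element killed by a power of `p` to the `k` in the coefficients
  have hkill : ∀ (k n : ℕ), (∀ a ∈ Submodule.torsionBy A A ((p : A) ^ n), (p : A) ^ k * a = 0) →
      ∀ z, (p : A) ^ k • ((TensorProduct.rid A M).toLinearMap ∘ₗ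
          LinearMap.lTensor M (Submodule.torsionBy A A ((p : A) ^ n)).subtype) z = 0 := by
    intro k n h z
    induction z with
    | zero => simp
    | add a b ha hb => rw [map_add, smul_add, ha, hb, add_zero]
    | tmul m a =>
      simp only [LinearMap.comp_apply, LinearMap.lTensor_tmul, Submodule.subtype_apply,
        LinearEquiv.coe_coe, TensorProduct.rid_tmul]
      rw [smul_smul, h a.1 a.2, zero_smul]
  have hsurj : ∀ (n : ℕ) (x : M), (p : A) ^ n • x = 0 → ∃ z,
      ((TensorProduct.rid A M).toLinearMap ∘ₗ
          LinearMap.lTensor M (Submodule.torsionBy A A ((p : A) ^ n)).subtype) z = x := by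
    intro n x hx
    let I : Ideal A := Ideal.span {(p : A) ^ n}
    have hpI : (p : A) ^ n ∈ I := Ideal.mem_span_singleton_self _
    have hI := hall n I hpI
    let g : A →ₗ[A] I := LinearMap.toSpanSingleton A I ⟨(p : A) ^ n, hpI⟩
    have hg : Function.Surjective g := by
      rintro ⟨y, hy⟩
      obtain ⟨a, ha⟩ := Ideal.mem_span_singleton'.1 hy
      exact ⟨a, Subtype.ext ha⟩
    have hex : Function.Exact (Submodule.torsionBy A A ((p : A) ^ n)).subtype g := by
      intro a
      have : g a = 0 ↔ a ∈ Submodule.torsionBy A A ((p : A) ^ n) := by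
        rw [Submodule.mem_torsionBy_iff, smul_eq_mul, mul_comm, ← Subtype.coe_inj]; rfl
      rw [this]
      simp
    obtain ⟨z, hz⟩ := (lTensor_exact M hex hg (x ⊗ₜ 1)).1 (by
      apply hI
      rw [map_zero, LinearMap.lTensor_tmul, LinearMap.lTensor_tmul]
      have : I.subtype (g 1) = (p : A) ^ n • (1 : A) := by
        change (1 : A) * (p : A) ^ n = _
        simp
      rw [this, ← TensorProduct.smul_tmul, hx, zero_tmul])
    refine ⟨z, ?_⟩
    rw [LinearMap.comp_apply, hz]
    simp
  refine ⟨fun n _ => ⟨?_, ?_⟩, ?_⟩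
  · rw [LinearMap.coe_comp]
    refine (TensorProduct.rid A M).injective.comp ?_
    let T := Submodule.torsionBy A A ((p : A) ^ n)
    let S : Ideal A := Ideal.span {(p : A) ^ c}
    have hd : Disjoint T S := by
      rw [Submodule.disjoint_def]
      intro a ha hs
      obtain ⟨b, rfl⟩ := Ideal.mem_span_singleton'.1 hs
      rw [Submodule.mem_torsionBy_iff, smul_eq_mul] at ha
      rw [mul_comm]
      exact hc (n + c) b (by rw [pow_add]; linear_combination ha)
    have hJ := hall c (T ⊔ S) (Ideal.mem_sup_right (Ideal.mem_span_singleton_self _))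
    let i : T →ₗ[A] (T ⊔ S : Ideal A) := Submodule.inclusion le_sup_left
    let e : (T × S) →ₗ[A] (T ⊔ S : Ideal A) :=
      i.coprod (Submodule.inclusion le_sup_right)
    have he : Function.Bijective e := by
      constructor
      · rw [injective_iff_map_eq_zero]
        rintro ⟨a, b⟩ h
        have h' : (a : A) + b = 0 := congrArg Subtype.val h
        have hb : (a : A) = -b := eq_neg_of_add_eq_zero_left h'
        have ha0 : (a : A) = 0 := (Submodule.disjoint_def.1 hd) a a.2 (by
          rw [hb]; exact S.neg_mem b.2)
        have hb0 : (b : A) = 0 := by rw [ha0, zero_add] at h'; exact h'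
        exact Prod.ext (Subtype.ext ha0) (Subtype.ext hb0)
      · rintro ⟨y, hy⟩
        obtain ⟨a, ha, b, hb, rfl⟩ := Submodule.mem_sup.1 hy
        exact ⟨(⟨a, ha⟩, ⟨b, hb⟩), rfl⟩
    let E := LinearEquiv.ofBijective e he
    let r : (T ⊔ S : Ideal A) →ₗ[A] T := LinearMap.fst A T S ∘ₗ E.symm.toLinearMap
    have hr : r ∘ₗ i = LinearMap.id := by
      ext1 t
      have : i t = E (t, 0) := by
        change i t = i t + Submodule.inclusion le_sup_right 0
        simp
      simp [r, this]
    have hi : Function.Injective (i.lTensor M) := by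
      apply Function.LeftInverse.injective (g := r.lTensor M)
      intro z
      rw [← LinearMap.lTensor_comp_apply, hr]; simp
    have := hJ.comp hi
    rw [← LinearMap.coe_comp, ← LinearMap.lTensor_comp] at this
    exact this
  · apply le_antisymm
    · rintro _ ⟨z, rfl⟩
      rw [Submodule.mem_torsionBy_iff]
      exact hkill n n (fun a ha => by simpa using ha) z
    · intro x hx
      exact hsurj n x (by simpa using hx)
  · rintro x ⟨n, hx⟩
    obtain ⟨z, rfl⟩ := hsurj n x hx
    exact hkill c n (fun a ha => hc n a (by simpa using ha)) z
end
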